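/- arXiv:math/0502176 — 5 statements merged into one kernel-verified Lean document; each statement's English description precedes it below -/
import Mathlib

section
/- Let A = e^{iπ/4} ∈ ℂ. For all integers a, b, k, l, the complex number a·A^k + b·A^l belongs to ℤΦ if and only if a·b = 0 or k ≡ l (mod 4). -/
open Complex

/-- The number `e^{iπ/4}` is a primitive 8th root of unity. -/
theorem isPrimitiveRoot_exp_pi_mul_I_div_four :
    IsPrimitiveRoot (Complex.exp (Real.pi * Complex.I / 4)) 8 := by
  have h := Complex.isPrimitiveRoot_exp 8 (by norm_num)
  convert h using 2
  push_cast
  ring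

theorem IsPrimitiveRoot.pow_four_eq_neg_one {w : ℂ} (hw : IsPrimitiveRoot w 8) : w ^ 4 = -1 :=
  (hw.pow (by norm_num) (show 8 = 4 * 2 by norm_num)).eq_neg_one_of_two_right

/-- The powers `1, w, w², w³` of a primitive 8th root of unity are independent over `ℤ`. -/
theorem IsPrimitiveRoot.eq_zero_of_sum_eq_zero {w : ℂ} (hw : IsPrimitiveRoot w 8)
    (c : Fin 4 → ℤ) (hc : ∑ i, (c i : ℂ) * w ^ (i : ℕ) = 0) (i : Fin 4) : c i = 0 := by
  have hdeg : (minpoly ℚ w).natDegree = 4 := by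
    rw [← Polynomial.cyclotomic_eq_minpoly_rat hw (by norm_num), Polynomial.natDegree_cyclotomic]
    decide
  have hli := linearIndependent_pow (K := ℚ) w
  rw [hdeg, Fintype.linearIndependent_iff] at hli
  have h := hli (fun j => (c j : ℚ)) (by simpa [Algebra.smul_def] using hc) i
  exact_mod_cast h

/-- Every integer power of a primitive 8th root of unity `w` is, up to sign,
a power with exponent reduced modulo `4`. -/
theorem IsPrimitiveRoot.exists_zpow_eq {w : ℂ} (hw : IsPrimitiveRoot w 8) (k : ℤ) :
    ∃ (s : ℤ) (r : Fin 4), s ≠ 0 ∧ ((r : ℕ) : ℤ) = k % 4 ∧ w ^ k = (s : ℂ) * w ^ (r : ℕ) := by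
  have h0 : w ≠ 0 := hw.ne_zero (by norm_num)
  obtain ⟨r, hr⟩ := Int.eq_ofNat_of_zero_le (Int.emod_nonneg k (by norm_num : (4 : ℤ) ≠ 0))
  have hr4 : r < 4 := by omega
  have hk : w ^ k = (-1) ^ (k / 4) * w ^ r := by
    rw [← hw.pow_four_eq_neg_one, ← zpow_natCast w 4, ← zpow_mul, ← zpow_natCast w r,
      ← zpow_add₀ h0]
    congr 1
    push_cast
    omega
  rcases Int.even_or_odd (k / 4) with h | h
  · exact ⟨1, ⟨r, hr4⟩, by norm_num, hr.symm, by rw [hk, h.neg_one_zpow]; simp⟩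
  · exact ⟨-1, ⟨r, hr4⟩, by norm_num, hr.symm, by rw [hk, h.neg_one_zpow]; simp⟩

/-- Proposition 2.10: with `A = e^{iπ/4}`, for integers `a b k l`,
`a·A^k + b·A^l ∈ ℤΦ` (where `Φ` is the set of 8th roots of unity and
`ℤΦ = {m·z : m ∈ ℤ, z ∈ Φ}`) iff `a·b = 0` or `k ≡ l (mod 4)`. -/
theorem stmt_1 (a b k l : ℤ) :
    (∃ (m : ℤ) (z : ℂ), z ^ 8 = 1 ∧
        (a : ℂ) * (Complex.exp (Real.pi * Complex.I / 4)) ^ k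
          + (b : ℂ) * (Complex.exp (Real.pi * Complex.I / 4)) ^ l = (m : ℂ) * z) ↔
      a * b = 0 ∨ k ≡ l [ZMOD 4] := by
  have hw := isPrimitiveRoot_exp_pi_mul_I_div_four
  set w := Complex.exp (Real.pi * Complex.I / 4)
  have hpow (n : ℤ) : (w ^ n) ^ 8 = 1 := by
    rw [← zpow_natCast, zpow_comm, zpow_natCast, hw.pow_eq_one, one_zpow]
  obtain ⟨s, p, hs, hp, hk⟩ := hw.exists_zpow_eq k
  obtain ⟨t, q, ht, hq, hl⟩ := hw.exists_zpow_eq l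
  constructor
  · rintro ⟨m, z, hz, h⟩
    by_contra! hne
    obtain ⟨hab, hkl⟩ := hne
    obtain ⟨j, -, rfl⟩ := hw.eq_pow_of_pow_eq_one hz
    obtain ⟨u, r, -, -, hj⟩ := hw.exists_zpow_eq j
    rw [zpow_natCast] at hj
    rw [hk, hl, hj] at h
    have hpq : p ≠ q := by
      rintro rfl
      exact hkl (hp.symm.trans hq)
    have hc := hw.eq_zero_of_sum_eq_zero
      (Pi.single p (a * s) + Pi.single q (b * t) - Pi.single r (m * u)) (by
        simp only [Pi.add_apply, Pi.sub_apply, Pi.single_apply, Int.cast_add, Int.cast_sub,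
          Int.cast_ite, Int.cast_zero, Int.cast_mul, add_mul, sub_mul, ite_mul, zero_mul,
          Finset.sum_add_distrib, Finset.sum_sub_distrib, Finset.sum_ite_eq',
          Finset.mem_univ, if_true]
        linear_combination h)
    have h1 := hc p
    have h2 := hc q
    simp only [Pi.add_apply, Pi.sub_apply, Pi.single_apply, if_true, hpq, hpq.symm, if_false]
      at h1 h2
    by_cases hpr : p = r
    · have hqr : q ≠ r := fun e => hpq (hpr.trans e.symm)
      simp_all
    · simp_all
  · rintro (h | h)
    · rcases mul_eq_zero.mp h with rfl | rfl
      · exact ⟨b, w ^ l, hpow l, by simp⟩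
      · exact ⟨a, w ^ k, hpow k, by simp⟩
    · have hpq : p = q := by
        have : (p : ℕ) = q := by unfold Int.ModEq at h; omega
        exact Fin.ext this
      refine ⟨a * s + b * t, w ^ (q : ℕ), by simpa using hpow (q : ℕ), ?_⟩
      rw [hk, hl, hpq]
      push_cast
      ring
end

section
/- Let A = e^{iπ/4} ∈ ℂ and let Φ = {z ∈ ℂ : z⁸ = 1}. For all integers p, q, k, the set {(z·p·A^k, i·z·q·A^{k+2}) : z ∈ Φ} ∩ (ℤ × ℤ) equals the two-element set {(p, −q), (−p, q)} (which degenerates to {(0,0)} when p = q = 0). -/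
open Complex

/-- The number `e^{iπ/4}` is a square root of `i`. -/
lemma exp_pi_mul_I_div_four_sq : Complex.exp (Real.pi * Complex.I / 4) ^ 2 = Complex.I := by
  rw [← Complex.exp_nat_mul]
  refine Eq.trans (congrArg Complex.exp ?_) Complex.exp_pi_div_two_mul_I
  push_cast
  ring

/-- An eighth root of unity that is a ratio of integers is `1` or `-1`. -/
lemma eq_one_or_eq_neg_one_of_pow_eight {u : ℂ} (hu : u ^ 8 = 1) {m n : ℤ} (hm : m ≠ 0)
    (h : u * m = n) : u = 1 ∨ u = -1 := by
  have hm' : (m : ℂ) ≠ 0 := Int.cast_ne_zero.mpr hm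
  have hpow : n ^ 8 = m ^ 8 := by
    have : (n : ℂ) ^ 8 = (m : ℂ) ^ 8 := by rw [← h, mul_pow, hu, one_mul]
    exact_mod_cast this
  rcases abs_eq_abs.mp ((pow_left_inj₀ (abs_nonneg n) (abs_nonneg m) (by norm_num : 8 ≠ 0)).mp
    (by rw [← abs_pow, ← abs_pow, hpow])) with rfl | rfl
  · left
    exact mul_right_cancel₀ hm' (by rw [h, one_mul])
  · right
    exact mul_right_cancel₀ hm' (by rw [h]; push_cast; ring)

/-- Well-definedness of the Krebes invariant (Definition 2.11 / Theorem 3.1):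
with `A = e^{iπ/4}` and `Φ` the 8th roots of unity, for integers `p q k`, the set
`{(z·p·A^k, i·z·q·A^{k+2}) : z ∈ Φ} ∩ (ℤ × ℤ)` equals `{(p, −q), (−p, q)}`. -/
theorem stmt_3 (p q k : ℤ) :
    {w : ℂ × ℂ | ∃ z : ℂ, z ^ 8 = 1 ∧
        w = (z * (p : ℂ) * (Complex.exp (Real.pi * Complex.I / 4)) ^ k,
             Complex.I * z * (q : ℂ) * (Complex.exp (Real.pi * Complex.I / 4)) ^ (k + 2))}
      ∩ {w : ℂ × ℂ | ∃ a b : ℤ, w = ((a : ℂ), (b : ℂ))} =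
    {(((p : ℤ) : ℂ), ((-q : ℤ) : ℂ)), (((-p : ℤ) : ℂ), ((q : ℤ) : ℂ))} := by
  set A := Complex.exp (Real.pi * Complex.I / 4) with hA
  have hA0 : A ≠ 0 := Complex.exp_ne_zero _
  have hA2 : A ^ 2 = Complex.I := exp_pi_mul_I_div_four_sq
  have hA8 : A ^ 8 = 1 := by rw [show 8 = 2 * 4 from rfl, pow_mul, hA2, Complex.I_pow_four]
  have hAk : (A ^ k) ^ 8 = 1 := by
    rw [← zpow_natCast, zpow_comm, zpow_natCast, hA8, one_zpow]
  have hAk2 : A ^ (k + 2) = A ^ k * Complex.I := by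
    rw [zpow_add₀ hA0, ← hA2, ← zpow_natCast]
    rfl
  have hsnd (z : ℂ) : Complex.I * z * q * A ^ (k + 2) = -(z * A ^ k * q) := by
    rw [hAk2]
    linear_combination (z * q * A ^ k) * Complex.I_mul_I
  ext w
  simp only [Set.mem_inter_iff, Set.mem_ofPred_eq, Set.mem_insert_iff, Set.mem_singleton_iff, hsnd]
  constructor
  · rintro ⟨⟨z, hz, rfl⟩, a, b, hab⟩
    obtain ⟨ha, hb⟩ := Prod.mk.inj hab
    rw [mul_right_comm] at ha ⊢
    have hu : (z * A ^ k) ^ 8 = 1 := by rw [mul_pow, hz, hAk, one_mul]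
    have hpm : (p = 0 ∧ q = 0) ∨ z * A ^ k = 1 ∨ z * A ^ k = -1 := by
      by_cases hp : p = 0
      · by_cases hq : q = 0
        · exact Or.inl ⟨hp, hq⟩
        · refine Or.inr (eq_one_or_eq_neg_one_of_pow_eight hu hq (n := -b) ?_)
          rw [Int.cast_neg, ← hb, neg_neg]
      · exact Or.inr (eq_one_or_eq_neg_one_of_pow_eight hu hp ha)
    rcases hpm with ⟨rfl, rfl⟩ | h | h
    · simp
    · simp [h]
    · simp [h]
  · have hAk0 : A ^ k ≠ 0 := zpow_ne_zero k hA0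
    have hinv : ((A ^ k)⁻¹) ^ 8 = 1 := by rw [inv_pow, hAk, inv_one]
    rintro (rfl | rfl)
    · refine ⟨⟨(A ^ k)⁻¹, hinv, ?_⟩, p, -q, rfl⟩
      rw [mul_right_comm, inv_mul_cancel₀ hAk0]
      simp
    · refine ⟨⟨-(A ^ k)⁻¹, by rw [Even.neg_pow (by decide), hinv], ?_⟩, -p, q, rfl⟩
      rw [mul_right_comm, neg_mul, inv_mul_cancel₀ hAk0]
      simp
end

section
/- Let C be the smallest subset of ℤ × ℤ that contains (q, 1) for every q ∈ ℤ and (0, r) for every r ∈ ℤ, and is closed under the three operations: horizontal sum (p,q), (r,s) ↦ (p·s + q·r, q·s); mirror (p,q) ↦ (p, −q); and rotation (p,q) ↦ (q, −p). Then C = ℤ × ℤ. -/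
/-- Arithmetic core of Theorem 4.4 (surjectivity of the ball tangle invariant):
any set `C ⊆ ℤ × ℤ` containing `(q,1)` and `(0,r)` for all integers `q, r` and
closed under horizontal sum, mirror, and rotation is all of `ℤ × ℤ`; hence the
smallest such set is `ℤ × ℤ`. -/
theorem stmt_7 (C : Set (ℤ × ℤ))
    (hseed1 : ∀ q : ℤ, (q, 1) ∈ C)
    (hseed2 : ∀ r : ℤ, (0, r) ∈ C)
    (hh : ∀ p q r s : ℤ, (p, q) ∈ C → (r, s) ∈ C → (p * s + q * r, q * s) ∈ C)
    (hm : ∀ p q : ℤ, (p, q) ∈ C → (p, -q) ∈ C)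
    (hr : ∀ p q : ℤ, (p, q) ∈ C → (q, -p) ∈ C) :
    C = Set.univ := by
  have swap : ∀ p q : ℤ, (p, q) ∈ C → (q, p) ∈ C := fun p q h => by
    simpa using hm _ _ (hr p q h)
  have shear : ∀ k p q : ℤ, (p, q) ∈ C → (p + q * k, q) ∈ C := fun k p q h => by
    have h' := hh k 1 p q (hseed1 k) h
    rwa [one_mul, one_mul, add_comm, mul_comm] at h'
  have key : ∀ n : ℕ, ∀ p q : ℤ, q.natAbs = n → (p, q) ∈ C := by
    intro n
    induction n using Nat.strong_induction_on with
    | _ n ih =>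
      intro p q hq
      rcases eq_or_ne q 0 with rfl | hq0
      · exact swap _ _ (hseed2 p)
      · have hlt : (p % q).natAbs < n := by
          have h1 := Int.emod_nonneg p hq0
          have h2 := Int.emod_lt_abs p hq0
          rw [Int.abs_eq_natAbs] at h2
          omega
        have hmem := shear (p / q) _ _ (swap _ _ (ih _ hlt q (p % q) rfl))
        rwa [Int.emod_add_mul_ediv] at hmem
  exact Set.eq_univ_of_forall fun x => key _ x.1 x.2 rfl
end

section
/- Let M be a 2×2 integer matrix and let G(M) be the smallest set of 2×2 integer matrices containing M and closed under the following operations: for any N = [[α, γ], [β, δ]] ∈ G(M) and any integers p, q, the four matrices [[p·β + q·α, p·δ + q·γ], [q·β, q·δ]], [[q·α, p·α + q·γ], [q·β, p·β + q·δ]], [[p·α, p·γ], [q·α + p·β, q·γ + p·δ]], and [[q·γ + p·α, p·γ], [q·δ + p·β, p·δ]] also belong to G(M). Then for every N ∈ G(M) there exists an integer n such that det N = n² · det M. -/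
/-- `Gen M N` means `N` lies in the smallest set of 2×2 integer matrices
containing `M` and closed under the four connect-sum operations of Lemma 4.18. -/
inductive Gen (M : Matrix (Fin 2) (Fin 2) ℤ) : Matrix (Fin 2) (Fin 2) ℤ → Prop
  | base : Gen M M
  | op1 (α β γ δ p q : ℤ) : Gen M !![α, γ; β, δ] →
      Gen M !![p * β + q * α, p * δ + q * γ; q * β, q * δ]
  | op2 (α β γ δ p q : ℤ) : Gen M !![α, γ; β, δ] →
      Gen M !![q * α, p * α + q * γ; q * β, p * β + q * δ]
  | op3 (α β γ δ p q : ℤ) : Gen M !![α, γ; β, δ] →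
      Gen M !![p * α, p * γ; q * α + p * β, q * γ + p * δ]
  | op4 (α β γ δ p q : ℤ) : Gen M !![α, γ; β, δ] →
      Gen M !![q * γ + p * α, p * γ; q * δ + p * β, p * δ]

/-- Theorem 4.20 (matrix level): every matrix generated from `M` by the four
connect-sum operations has determinant `n² · det M` for some integer `n`. -/
theorem stmt_10 (M N : Matrix (Fin 2) (Fin 2) ℤ) (h : Gen M N) :
    ∃ n : ℤ, N.det = n ^ 2 * M.det := by
  induction h with
  | base => exact ⟨1, by ring⟩
  | op1 α β γ δ p q _ ih | op2 α β γ δ p q _ ih =>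
    obtain ⟨n, hn⟩ := ih
    refine ⟨q * n, ?_⟩
    rw [Matrix.det_fin_two_of] at hn ⊢
    linear_combination q ^ 2 * hn
  | op3 α β γ δ p q _ ih | op4 α β γ δ p q _ ih =>
    obtain ⟨n, hn⟩ := ih
    refine ⟨p * n, ?_⟩
    rw [Matrix.det_fin_two_of] at hn ⊢
    linear_combination p ^ 2 * hn
end

section
/- Let A = e^{iπ/4} ∈ ℂ. Suppose a, a', b, b' ∈ ℤ and k, k', l, l' ∈ ℤ satisfy a·A^k − a'·A^{k'} = 4·b·A^{l−1} − 4·b'·A^{l'−1}. Then there exists ε ∈ {1, −1} such that a ≡ ε·a' (mod 4). -/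
open Complex

/-- An integral power of a fourth root of `-1` is, up to sign, one of its first four powers. -/
theorem exists_zpow_eq_sign_mul_pow {K : Type*} [Field K] {A : K} (hA : A ^ 4 = -1) (n : ℤ) :
    ∃ (j : Fin 4) (s : ℤ), (s = 1 ∨ s = -1) ∧ A ^ n = s * A ^ (j : ℕ) := by
  have hA0 : A ≠ 0 := by
    rintro rfl
    simp at hA
  have hlt : (n % 4).toNat < 4 := by omega
  have hn : n = 4 * (n / 4) + ((n % 4).toNat : ℤ) := by omega
  have hpow : A ^ n = (-1) ^ (n / 4) * A ^ (n % 4).toNat := by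
    conv_lhs => rw [hn, zpow_add₀ hA0, zpow_mul, zpow_natCast]
    congr 2
    exact_mod_cast hA
  rcases Int.even_or_odd (n / 4) with he | ho
  · exact ⟨⟨_, hlt⟩, 1, Or.inl rfl, by rw [hpow, he.neg_one_zpow]; simp⟩
  · exact ⟨⟨_, hlt⟩, -1, Or.inr rfl, by rw [hpow, ho.neg_one_zpow]; simp⟩

theorem IsPrimitiveRoot.linearIndependent_int_pow {K : Type*} [Field K] [CharZero K] {ζ : K}
    {n : ℕ} (hζ : IsPrimitiveRoot ζ n) (hn : 0 < n) :
    LinearIndependent ℤ fun i : Fin n.totient => ζ ^ (i : ℕ) := by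
  have hdeg : (minpoly ℚ ζ).natDegree = n.totient := by
    rw [← Polynomial.cyclotomic_eq_minpoly_rat hζ hn, Polynomial.natDegree_cyclotomic]
  have hli := linearIndependent_pow (K := ℚ) ζ
  rw [hdeg] at hli
  exact hli.restrict_scalars' ℤ

/-- Arithmetic core of Lemma 4.22: with `A = e^{iπ/4}`, if
`a·A^k − a'·A^{k'} = 4b·A^{l−1} − 4b'·A^{l'−1}`, then `a ≡ ±a' (mod 4)`. -/
theorem stmt_11 (a a' b b' k k' l l' : ℤ)
    (h : (a : ℂ) * (Complex.exp (Real.pi * Complex.I / 4)) ^ k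
          - (a' : ℂ) * (Complex.exp (Real.pi * Complex.I / 4)) ^ k'
        = 4 * (b : ℂ) * (Complex.exp (Real.pi * Complex.I / 4)) ^ (l - 1)
          - 4 * (b' : ℂ) * (Complex.exp (Real.pi * Complex.I / 4)) ^ (l' - 1)) :
    ∃ ε : ℤ, (ε = 1 ∨ ε = -1) ∧ a ≡ ε * a' [ZMOD 4] := by
  have hprim := isPrimitiveRoot_exp_pi_mul_I_div_four
  have hA : Complex.exp (Real.pi * Complex.I / 4) ^ 4 = -1 := by
    rw [← Complex.exp_nat_mul, ← Complex.exp_pi_mul_I]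
    congr 1
    push_cast
    ring
  generalize Complex.exp (Real.pi * Complex.I / 4) = A at h hprim hA
  have hli : LinearIndependent ℤ fun i : Fin 4 => A ^ (i : ℕ) :=
    hprim.linearIndependent_int_pow (by norm_num)
  obtain ⟨j, s, hs, hj⟩ := exists_zpow_eq_sign_mul_pow hA k
  obtain ⟨j', s', hs', hj'⟩ := exists_zpow_eq_sign_mul_pow hA k'
  obtain ⟨p, t, -, hp⟩ := exists_zpow_eq_sign_mul_pow hA (l - 1)
  obtain ⟨p', t', -, hp'⟩ := exists_zpow_eq_sign_mul_pow hA (l' - 1)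
  rw [hj, hj', hp, hp'] at h
  have hcoeff := Fintype.linearIndependent_iff.mp hli
    (fun i => (if i = j then a * s else 0) - (if i = j' then a' * s' else 0)
      - 4 * ((if i = p then b * t else 0) - (if i = p' then b' * t' else 0))) (by
    simp only [sub_smul, mul_smul, ite_smul, zero_smul, Finset.sum_sub_distrib,
      ← Finset.smul_sum, Finset.sum_ite_eq', Finset.mem_univ, if_true]
    simp only [zsmul_eq_mul]
    push_cast
    linear_combination h)
  have hcj := hcoeff j
  have hcj' := hcoeff j'
  simp only [if_true] at hcj hcj'
  generalize (if j = p then b * t else 0) - (if j = p' then b' * t' else 0) = u at hcj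
  generalize (if j' = p then b * t else 0) - (if j' = p' then b' * t' else 0) = v at hcj'
  have hmod : a ≡ a' [ZMOD 4] ∨ a ≡ -a' [ZMOD 4] := by
    unfold Int.ModEq
    by_cases hjj : j = j'
    · rw [if_pos hjj] at hcj
      rcases hs with rfl | rfl <;> rcases hs' with rfl | rfl <;> omega
    · rw [if_neg hjj] at hcj
      rw [if_neg (Ne.symm hjj)] at hcj'
      rcases hs with rfl | rfl <;> rcases hs' with rfl | rfl <;> omega
  rcases hmod with hm | hm
  · exact ⟨1, Or.inl rfl, by simpa using hm⟩
  · exact ⟨-1, Or.inr rfl, by simpa using hm⟩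
end
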